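/- arXiv:2009.12513 — 3 statements merged into one kernel-verified Lean document; each statement's English description precedes it below -/
import Mathlib

section
/- Let k ≥ 2 be an integer and let ζ: ℝ → ℝ, f, g: ℝ×ℝ → ℝ be C^∞ functions. Define φ: ℝ² → ℝ² by φ(x,y) = ( x + ζ(y) + y^k·f(x,y) , y + y^{k+1}·g(x,y) ). Suppose φ preserves the area form y dy∧dx, in the sense that for all (x,y) the Jacobian determinant of φ at (x,y) multiplied by the second component y + y^{k+1}g(x,y) equals y. Then for every x, (k+2)·g(x,0) + ∂f/∂x(x,0) = 0. -/
theorem hasDerivAt_partial_fst {f : ℝ → ℝ → ℝ}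
    (hf : Differentiable ℝ (fun p : ℝ × ℝ => f p.1 p.2)) (x y : ℝ) :
    HasDerivAt (fun t => f t y) (fderiv ℝ (fun p : ℝ × ℝ => f p.1 p.2) (x, y) (1, 0)) x :=
  (hf (x, y)).hasFDerivAt.comp_hasDerivAt (f := fun t => (t, y)) x
    ((hasDerivAt_id x).prodMk (hasDerivAt_const x y))

theorem hasDerivAt_partial_snd {f : ℝ → ℝ → ℝ}
    (hf : Differentiable ℝ (fun p : ℝ × ℝ => f p.1 p.2)) (x y : ℝ) :
    HasDerivAt (fun t => f x t) (fderiv ℝ (fun p : ℝ × ℝ => f p.1 p.2) (x, y) (0, 1)) y :=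
  (hf (x, y)).hasFDerivAt.comp_hasDerivAt (f := fun t => (x, t)) y
    ((hasDerivAt_const y x).prodMk (hasDerivAt_id y))

/-- Symplectic Constraint Lemma: if the billiard-type map
`φ(x,y) = (x + ζ(y) + y^k f(x,y), y + y^(k+1) g(x,y))` preserves the area form
`y dy ∧ dx` (i.e. its Jacobian determinant times the second component equals
`y`), then `(k+2) g(x,0) + f_x(x,0) = 0` for all `x`. -/
theorem symplectic_constraint (k : ℕ) (hk : 2 ≤ k) (ζ : ℝ → ℝ)
    (f g : ℝ → ℝ → ℝ)
    (hζ : ContDiff ℝ (⊤ : ℕ∞) ζ)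
    (hf : ContDiff ℝ (⊤ : ℕ∞) (fun p : ℝ × ℝ => f p.1 p.2))
    (hg : ContDiff ℝ (⊤ : ℕ∞) (fun p : ℝ × ℝ => g p.1 p.2))
    (F G : ℝ → ℝ → ℝ)
    (hF : ∀ x y, F x y = x + ζ y + y ^ k * f x y)
    (hG : ∀ x y, G x y = y + y ^ (k + 1) * g x y)
    (harea : ∀ x y,
      (deriv (fun t => F t y) x * deriv (fun t => G x t) y -
          deriv (fun t => F x t) y * deriv (fun t => G t y) x) * G x y = y) :
    ∀ x, (k + 2 : ℝ) * g x 0 + deriv (fun t => f t 0) x = 0 := by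
  intro x
  have hfd := hf.differentiable (by simp)
  have hgd := hg.differentiable (by simp)
  have hf' := hf.continuous_fderiv (by simp)
  have hg' := hg.continuous_fderiv (by simp)
  have hζ' := hζ.continuous_deriv (by simp)
  have hp : Continuous fun y : ℝ => (x, y) := by fun_prop
  have hfc : Continuous fun y => f x y := hf.continuous.comp hp
  have hgc : Continuous fun y => g x y := hg.continuous.comp hp
  obtain ⟨fx, hfx, hdfx⟩ : ∃ u : ℝ → ℝ, Continuous u ∧
      ∀ y, HasDerivAt (fun t => f t y) (u y) x :=
    ⟨_, (hf'.comp hp).clm_apply continuous_const, hasDerivAt_partial_fst hfd x⟩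
  obtain ⟨fy, hfy, hdfy⟩ : ∃ u : ℝ → ℝ, Continuous u ∧
      ∀ y, HasDerivAt (fun t => f x t) (u y) y :=
    ⟨_, (hf'.comp hp).clm_apply continuous_const, hasDerivAt_partial_snd hfd x⟩
  obtain ⟨gx, hgx, hdgx⟩ : ∃ u : ℝ → ℝ, Continuous u ∧
      ∀ y, HasDerivAt (fun t => g t y) (u y) x :=
    ⟨_, (hg'.comp hp).clm_apply continuous_const, hasDerivAt_partial_fst hgd x⟩
  obtain ⟨gy, hgy, hdgy⟩ : ∃ u : ℝ → ℝ, Continuous u ∧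
      ∀ y, HasDerivAt (fun t => g x t) (u y) y :=
    ⟨_, (hg'.comp hp).clm_apply continuous_const, hasDerivAt_partial_snd hgd x⟩
  have hFx (y : ℝ) : deriv (fun t => F t y) x = 1 + y ^ k * fx y := by
    simp only [hF]
    exact (((hasDerivAt_id x).add_const _).add ((hdfx y).const_mul _)).deriv
  have hGx (y : ℝ) : deriv (fun t => G t y) x = y ^ (k + 1) * gx y := by
    simp only [hG]
    exact (((hdgx y).const_mul _).const_add _).deriv
  have hFy (y : ℝ) : deriv (fun t => F x t) y =
      deriv ζ y + (k * y ^ (k - 1) * f x y + y ^ k * fy y) := by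
    simp only [hF]
    exact (((hζ.differentiable (by simp) y).hasDerivAt.const_add x).add
      ((hasDerivAt_pow k y).mul (hdfy y))).deriv
  have hGy (y : ℝ) : deriv (fun t => G x t) y =
      1 + (((k + 1 : ℕ) : ℝ) * y ^ k * g x y + y ^ (k + 1) * gy y) := by
    simp only [hG]
    exact ((hasDerivAt_id y).add ((hasDerivAt_pow (k + 1) y).mul (hdgy y))).deriv
  -- The area identity minus `y`, divided by `y ^ (k + 1)`.
  let b : ℝ → ℝ := fun y => (k + 1) * g x y + y * gy y
  let c : ℝ → ℝ := fun y => (deriv ζ y + (k * y ^ (k - 1) * f x y + y ^ k * fy y)) * gx y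
  let H : ℝ → ℝ := fun y => fx y + b y + y ^ k * (fx y * b y) - y * c y
    + g x y * ((1 + y ^ k * fx y) * (1 + y ^ k * b y) - y ^ (k + 1) * c y)
  have hH : Continuous H := by fun_prop
  have hH0 : Set.EqOn H 0 {0}ᶜ := by
    intro y hy
    have hy : y ≠ 0 := hy
    have h := harea x y
    rw [hFx, hGx, hFy, hGy, hG] at h
    have : y ^ (k + 1) * H y = 0 := by
      simp only [H, b, c]
      push_cast at h
      linear_combination h
    exact (mul_eq_zero.mp this).resolve_left (pow_ne_zero _ hy)
  have h0 := congrFun (hH.ext_on (dense_compl_singleton 0) continuous_zero hH0) 0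
  have hk0 : k ≠ 0 := by omega
  simp only [H, b, zero_pow hk0, zero_pow k.succ_ne_zero, Pi.zero_apply] at h0
  rw [(hdfx 0).deriv]
  linear_combination h0
end

section
/- Let k ≥ 2 be an even integer, let ζ: ℝ → ℝ be a polynomial function of degree at most k−1 with ζ(0) = 0, and let f, g: ℝ×ℝ → ℝ be continuous. Define φ: ℝ² → ℝ² by φ(x,y) = ( x + ζ(y) + y^k·f(x,y) , y + y^{k+1}·g(x,y) ), and let T(x,y) = (x,−y). If φ∘T∘φ = T on all of ℝ², then ζ is odd (all even-degree coefficients of ζ vanish), and f(x,0) = 0 and g(x,0) = 0 for every x. -/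
open Filter Topology in
/-- A polynomial of degree less than `k` that is `O(y ^ k)` at the origin, with a limiting
quotient, is zero. -/
theorem Polynomial.eq_zero_of_eval_eq_pow_mul (k : ℕ) (R : Polynomial ℝ) (H : ℝ → ℝ) (l : ℝ)
    (hR : R.degree < k) (hH : Tendsto H (𝓝[≠] 0) (𝓝 l))
    (h : ∀ y, y ≠ 0 → R.eval y = y ^ k * H y) : R = 0 := by
  induction k generalizing R with
  | zero => simpa [Polynomial.degree_lt_iff_coeff_zero, Polynomial.ext_iff] using hR
  | succ k ih =>
    have hid : Tendsto (fun y : ℝ => y) (𝓝[≠] 0) (𝓝 0) := tendsto_nhdsWithin_of_tendsto_nhds tendsto_id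
    have h1 : Tendsto (fun y => R.eval y) (𝓝[≠] 0) (𝓝 (R.eval 0)) :=
      R.continuous.continuousAt.tendsto.comp hid
    have h2 : Tendsto (fun y => R.eval y) (𝓝[≠] 0) (𝓝 0) := by
      have h3 := (hid.pow (k + 1)).mul hH
      rw [zero_pow (Nat.succ_ne_zero k), zero_mul] at h3
      refine h3.congr' ?_
      filter_upwards [self_mem_nhdsWithin] with y hy using (h y hy).symm
    have h0 : R.coeff 0 = 0 := by
      rw [Polynomial.coeff_zero_eq_eval_zero]
      exact tendsto_nhds_unique h1 h2
    obtain ⟨S, rfl⟩ := Polynomial.X_dvd_iff.mpr h0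
    have hS : S = 0 := by
      refine ih S ?_ fun y hy => ?_
      · rw [Polynomial.degree_lt_iff_coeff_zero] at hR ⊢
        intro m hm
        simpa using hR (m + 1) (by omega)
      · have := h y hy
        rw [Polynomial.eval_mul, Polynomial.eval_X, pow_succ', mul_assoc] at this
        exact mul_left_cancel₀ hy this
    rw [hS, mul_zero]

/-- The difference quotient of a real polynomial extends continuously to the diagonal. -/
theorem Polynomial.exists_continuous_eval_sub_eval (P : Polynomial ℝ) :
    ∃ Q : ℝ → ℝ → ℝ, Continuous (fun p : ℝ × ℝ => Q p.1 p.2) ∧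
      ∀ a b, P.eval a - P.eval b = (a - b) * Q a b := by
  induction P using Polynomial.induction_on' with
  | add p q hp hq =>
    obtain ⟨Q₁, hc₁, h₁⟩ := hp
    obtain ⟨Q₂, hc₂, h₂⟩ := hq
    refine ⟨fun a b => Q₁ a b + Q₂ a b, hc₁.add hc₂, fun a b => ?_⟩
    simp only [Polynomial.eval_add]
    linear_combination h₁ a b + h₂ a b
  | monomial n c =>
    refine ⟨fun a b => c * ∑ i ∈ Finset.range n, a ^ i * b ^ (n - 1 - i), by fun_prop,
      fun a b => ?_⟩
    have := (Commute.all a b).geom_sum₂_mul n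
    simp only [Polynomial.eval_monomial]
    linear_combination -c * this

theorem Polynomial.coeff_comp_neg_X (P : Polynomial ℝ) (n : ℕ) :
    (P.comp (-Polynomial.X)).coeff n = P.coeff n * (-1) ^ n := by
  rw [show (-Polynomial.X : Polynomial ℝ) = Polynomial.C (-1) * Polynomial.X by simp,
    Polynomial.comp_C_mul_X_coeff]

/-- Symmetric Constraint Lemma: for even `k ≥ 2`, if the billiard-type map
`φ(x,y) = (x + ζ(y) + y^k f(x,y), y + y^(k+1) g(x,y))` with `ζ` a polynomial
of degree at most `k-1` vanishing at `0` is mirror symmetric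
(`φ ∘ T ∘ φ = T`), then `ζ` is odd (all even-degree coefficients vanish) and
`f(x,0) = 0`, `g(x,0) = 0` for every `x`. -/
theorem symmetric_constraint (k : ℕ) (hk : 2 ≤ k) (hke : Even k)
    (P : Polynomial ℝ) (hdeg : P.natDegree ≤ k - 1) (hP0 : P.eval 0 = 0)
    (f g : ℝ → ℝ → ℝ)
    (hf : Continuous (fun p : ℝ × ℝ => f p.1 p.2))
    (hg : Continuous (fun p : ℝ × ℝ => g p.1 p.2))
    (φ T : ℝ × ℝ → ℝ × ℝ)
    (hφ : ∀ x y, φ (x, y) = (x + P.eval y + y ^ k * f x y,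
                             y + y ^ (k + 1) * g x y))
    (hT : ∀ x y, T (x, y) = (x, -y))
    (hrev : ∀ p, φ (T (φ p)) = T p) :
    (∀ i, Even i → P.coeff i = 0) ∧ (∀ x, f x 0 = 0) ∧ (∀ x, g x 0 = 0) := by
  have key : ∀ x y, (x + P.eval y + y ^ k * f x y)
        + P.eval (-(y + y ^ (k + 1) * g x y)) + (y + y ^ (k + 1) * g x y) ^ k
          * f (x + P.eval y + y ^ k * f x y) (-(y + y ^ (k + 1) * g x y)) = x ∧
      (y + y ^ (k + 1) * g x y) + (y + y ^ (k + 1) * g x y) ^ (k + 1)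
          * g (x + P.eval y + y ^ k * f x y) (-(y + y ^ (k + 1) * g x y)) = y := by
    intro x y
    have h := hrev (x, y)
    simp only [hφ, hT, Prod.mk.injEq, hke.neg_pow, hke.add_one.neg_pow] at h
    exact ⟨h.1, by linear_combination -h.2⟩
  have hk0 : k ≠ 0 := by omega
  have hid : Filter.Tendsto (fun y : ℝ => y) (nhdsWithin 0 {0}ᶜ) (nhds 0) :=
    tendsto_nhdsWithin_of_tendsto_nhds Filter.tendsto_id
  have hfx (x : ℝ) : Continuous (f x) := hf.comp (Continuous.prodMk_right x)
  have hgx (x : ℝ) : Continuous (g x) := hg.comp (Continuous.prodMk_right x)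
  have hP := P.continuous
  obtain ⟨Q, hQ, hPQ⟩ := P.exists_continuous_eval_sub_eval
  have hX (x : ℝ) : Continuous fun y => x + P.eval y + y ^ k * f x y := by
    have := hfx x
    fun_prop
  have hY (x : ℝ) : Continuous fun y => -(y + y ^ (k + 1) * g x y) := by
    have := hgx x
    fun_prop
  have hU (x : ℝ) : Continuous fun y => 1 + y ^ k * g x y := by
    have := hgx x
    fun_prop
  have hg0 : ∀ x, g x 0 = 0 := by
    intro x
    let G : ℝ → ℝ := fun y => g x y + (1 + y ^ k * g x y) ^ (k + 1)
      * g (x + P.eval y + y ^ k * f x y) (-(y + y ^ (k + 1) * g x y))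
    have hG : Continuous G :=
      (hgx x).add (((hU x).pow _).mul (hg.comp ((hX x).prodMk (hY x))))
    have hz : ∀ y, y ≠ 0 → G y = 0 := by
      intro y hy
      refine mul_left_cancel₀ (pow_ne_zero (k + 1) hy) ?_
      have h := (key x y).2
      rw [show y + y ^ (k + 1) * g x y = y * (1 + y ^ k * g x y) by ring, mul_pow] at h
      simp only [G]
      rw [show y + y ^ (k + 1) * g x y = y * (1 + y ^ k * g x y) by ring]
      linear_combination h
    have hlim : Filter.Tendsto G (nhdsWithin 0 {0}ᶜ) (nhds 0) :=
      tendsto_const_nhds.congr' (by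
        filter_upwards [self_mem_nhdsWithin] with y hy using (hz y hy).symm)
    have h0 := tendsto_nhds_unique ((hG.tendsto 0).comp hid) hlim
    simp [G, hk0, hP0] at h0
    linarith
  let H : ℝ → ℝ → ℝ := fun x y => y * g x y * Q (-(y + y ^ (k + 1) * g x y)) (-y)
    - (f x y + (1 + y ^ k * g x y) ^ k
      * f (x + P.eval y + y ^ k * f x y) (-(y + y ^ (k + 1) * g x y)))
  have hH (x : ℝ) : Continuous (H x) :=
    ((continuous_id.mul (hgx x)).mul (hQ.comp ((hY x).prodMk continuous_neg))).sub
      ((hfx x).add (((hU x).pow _).mul (hf.comp ((hX x).prodMk (hY x)))))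
  have hR : ∀ x y, (P + P.comp (-Polynomial.X)).eval y = y ^ k * H x y := by
    intro x y
    have h := (key x y).1
    have hq := hPQ (-(y + y ^ (k + 1) * g x y)) (-y)
    have hpow : (y + y ^ (k + 1) * g x y) ^ k = y ^ k * (1 + y ^ k * g x y) ^ k := by
      rw [← mul_pow]
      ring
    rw [hpow] at h
    simp only [Polynomial.eval_add, Polynomial.eval_comp, Polynomial.eval_neg,
      Polynomial.eval_X, H]
    linear_combination h - hq
  have hR0 : P + P.comp (-Polynomial.X) = 0 := by
    refine Polynomial.eq_zero_of_eval_eq_pow_mul k _ (H 0) _ ?_ (((hH 0).tendsto 0).comp hid)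
      fun y _ => hR 0 y
    rw [Polynomial.degree_lt_iff_coeff_zero]
    intro m hm
    have : P.coeff m = 0 := Polynomial.coeff_eq_zero_of_natDegree_lt (by omega)
    simp [Polynomial.coeff_comp_neg_X, this]
  refine ⟨fun i hi => ?_, fun x => ?_, hg0⟩
  · have := congrArg (fun p => Polynomial.coeff p i) hR0
    simp [Polynomial.coeff_comp_neg_X, hi.neg_one_pow] at this
    linarith
  · have hz : ∀ y, y ≠ 0 → H x y = 0 := by
      intro y hy
      have h := hR x y
      rw [hR0, Polynomial.eval_zero, eq_comm] at h
      exact (mul_eq_zero.mp h).resolve_left (pow_ne_zero k hy)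
    have hlim : Filter.Tendsto (H x) (nhdsWithin 0 {0}ᶜ) (nhds 0) :=
      tendsto_const_nhds.congr' (by
        filter_upwards [self_mem_nhdsWithin] with y hy using (hz y hy).symm)
    have h0 := tendsto_nhds_unique (((hH x).tendsto 0).comp hid) hlim
    simp [H, hk0, hP0] at h0
    linarith
end

section
/- Let N ∈ ℕ and c₃, c₅, …, c_{2N+1} ∈ ℝ, and define ζ(y) = y + ∑_{i=1}^{N} c_{2i+1}·y^{2i+1}. Then for every w ≥ 0, setting c = w²/2 and h = ζ(w), one has c·h − ∫₀^c ζ(√(2t)) dt = (√2/3)·c^{3/2} + ∑_{i=1}^{N} ((2i+1)/(2i+3))·c_{2i+1}·√(2^{2i+1})·c^{(2i+3)/2}. -/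
theorem integral_sqrt_two_mul_pow (m : ℕ) {w : ℝ} (hw : 0 ≤ w) :
    ∫ t in (0 : ℝ)..(w ^ 2 / 2), Real.sqrt (2 * t) ^ m = w ^ (m + 2) / ((m : ℝ) + 2) := by
  have h := intervalIntegral.integral_comp_mul_deriv (a := 0) (b := w)
    (f := fun s : ℝ => s ^ 2 / 2) (f' := fun s => s) (g := fun t => Real.sqrt (2 * t) ^ m)
    (fun s _ => by simpa using (hasDerivAt_pow 2 s).div_const 2)
    continuousOn_id (by fun_prop)
  have h0 : (0 : ℝ) ^ 2 / 2 = 0 := by norm_num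
  simp only [h0] at h
  rw [← h]
  have hpow : ∫ s in (0 : ℝ)..w, s ^ (m + 1) = w ^ (m + 2) / ((m : ℝ) + 2) := by
    rw [integral_pow]
    push_cast
    ring_nf
  rw [← hpow]
  refine intervalIntegral.integral_congr fun s hs => ?_
  rw [Set.uIcc_of_le hw] at hs
  simp only [Function.comp_apply]
  rw [mul_div_cancel₀ _ two_ne_zero, Real.sqrt_sq hs.1, pow_succ]

theorem sqrt_two_pow_mul_rpow (m : ℕ) {w : ℝ} (hw : 0 ≤ w) :
    Real.sqrt (2 ^ m) * (w ^ 2 / 2) ^ (((m : ℝ) + 2) / 2) = w ^ (m + 2) / 2 := by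
  have hcast : (m : ℝ) + 2 = ((m + 2 : ℕ) : ℝ) := by push_cast; rfl
  have h2 : Real.sqrt 2 ^ 2 = 2 := Real.sq_sqrt zero_le_two
  have hpos : Real.sqrt 2 ≠ 0 := by positivity
  have hsqrt : Real.sqrt (2 ^ m) = Real.sqrt 2 ^ m :=
    Real.sqrt_eq_iff_mul_self_eq (by positivity) (by positivity) |>.2 (by
      rw [← pow_add, ← two_mul, pow_mul, h2])
  rw [Real.rpow_div_two_eq_sqrt _ (by positivity), hcast, Real.rpow_natCast,
    Real.sqrt_div (sq_nonneg w), Real.sqrt_sq hw, hsqrt, div_pow, pow_add (Real.sqrt 2), h2]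
  field_simp

theorem half_sq_mul_pow_sub_integral (m : ℕ) {w : ℝ} (hw : 0 ≤ w) :
    w ^ 2 / 2 * w ^ m - ∫ t in (0 : ℝ)..(w ^ 2 / 2), Real.sqrt (2 * t) ^ m =
      (m : ℝ) / ((m : ℝ) + 2) *
        (Real.sqrt (2 ^ m) * (w ^ 2 / 2) ^ (((m : ℝ) + 2) / 2)) := by
  rw [integral_sqrt_two_mul_pow m hw, sqrt_two_pow_mul_rpow m hw]
  have : (m : ℝ) + 2 ≠ 0 := by positivity
  field_simp
  ring


/-- Explicit formula for the β-function of the integrable normal form with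
`ζ(y) = y + ∑_{i=1}^N c_{2i+1} y^(2i+1)`: for `w ≥ 0`, `c = w²/2`,
`h = ζ(w)`, one has
`c h - ∫₀^c ζ(√(2t)) dt
  = (√2/3) c^(3/2) + ∑_{i=1}^N ((2i+1)/(2i+3)) c_{2i+1} √(2^(2i+1)) c^((2i+3)/2)`. -/
theorem beta_explicit_formula (N : ℕ) (c : ℕ → ℝ) (ζ : ℝ → ℝ)
    (hζ : ∀ y, ζ y = y + ∑ i ∈ Finset.Icc 1 N, c (2 * i + 1) * y ^ (2 * i + 1))
    (w : ℝ) (hw : 0 ≤ w) :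
    (w ^ 2 / 2) * ζ w - ∫ t in (0:ℝ)..(w ^ 2 / 2), ζ (Real.sqrt (2 * t)) =
      (Real.sqrt 2 / 3) * (w ^ 2 / 2) ^ ((3 : ℝ) / 2) +
        ∑ i ∈ Finset.Icc 1 N,
          ((2 * (i : ℝ) + 1) / (2 * (i : ℝ) + 3)) * c (2 * i + 1) *
            Real.sqrt (2 ^ (2 * i + 1)) *
            (w ^ 2 / 2) ^ ((2 * (i : ℝ) + 3) / 2) := by
  have hint (m : ℕ) : IntervalIntegrable (fun t => Real.sqrt (2 * t) ^ m)
      MeasureTheory.volume 0 (w ^ 2 / 2) :=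
    Continuous.intervalIntegrable (by fun_prop) _ _
  have hfirst := half_sq_mul_pow_sub_integral 1 hw
  simp only [pow_one, Nat.cast_one] at hfirst
  simp only [hζ]
  rw [intervalIntegral.integral_add (by simpa using hint 1)
      (Continuous.intervalIntegrable (by fun_prop) _ _),
    intervalIntegral.integral_finsetSum fun i _ => (hint (2 * i + 1)).const_mul _,
    mul_add, add_sub_add_comm, hfirst, Finset.mul_sum, ← Finset.sum_sub_distrib]
  congr 1
  · norm_num
    ring
  · refine Finset.sum_congr rfl fun i _ => ?_
    have hterm := half_sq_mul_pow_sub_integral (2 * i + 1) hw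
    have hcast : ((2 * i + 1 : ℕ) : ℝ) + 2 = 2 * (i : ℝ) + 3 := by push_cast; ring
    rw [hcast] at hterm
    push_cast at hterm
    rw [intervalIntegral.integral_const_mul]
    linear_combination c (2 * i + 1) * hterm
end
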